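/- arXiv:1211.2131 — 2 statements merged into one kernel-verified Lean document; each statement's English description precedes it below -/
import Mathlib

section
/- Let m ≤ n − 1 and let A_1,…,A_m be real symmetric n×n matrices. If there is no x ∈ ℝⁿ with xᵀx = 1 and xᵀ A_i x = 0 for all i = 1,…,m, then there exists a vector x̂ ∈ ℝⁿ with ‖x̂‖ = 1 such that, setting δ = −x̂_n, one has δ ∈ (0, 1), x̂ᵀ A_i x̂ = −x̂_i/δ for i = 1,…,m, and consequently x̂ᵀ(∑_{i=1}^m (−x̂_i) A_i) x̂ = (1 − δ²)/δ > 0. -/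
open Matrix

/-- A contractive perturbation of the identity is a bijection. -/
theorem LipschitzWith.bijective_id_add {E : Type*} [NormedAddCommGroup E] [CompleteSpace E]
    {K : NNReal} (hK : K < 1) {p : E → E} (hp : LipschitzWith K p) :
    Function.Bijective fun x => x + p x := by
  constructor
  · intro x y hxy
    have h1 : ‖p y - p x‖ ≤ K * ‖y - x‖ := hp.norm_sub_le y x
    have h2 : x - y = p y - p x := by
      have hxy' : x + p x = y + p y := hxy
      rw [sub_eq_sub_iff_add_eq_add, hxy', add_comm]
    rw [← h2, norm_sub_rev y x] at h1
    have hK' : (K : ℝ) < 1 := hK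
    have h3 : ‖x - y‖ = 0 := by nlinarith [norm_nonneg (x - y)]
    exact sub_eq_zero.1 (norm_eq_zero.1 h3)
  · intro y
    have hc : ContractingWith K fun x => y - p x :=
      ⟨hK, LipschitzWith.of_dist_le_mul fun a b => by
        rw [dist_sub_left]; exact hp.dist_le_mul a b⟩
    refine ⟨ContractingWith.fixedPoint _ hc, ?_⟩
    have h := hc.fixedPoint_isFixedPt
    have h' : y - p (ContractingWith.fixedPoint _ hc) = ContractingWith.fixedPoint _ hc := h
    exact (sub_eq_iff_eq_add.1 h').symm

/-- A map that is Lipschitz on a ball and vanishes on the bounding sphere stays Lipschitz with the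
same constant when it is extended by zero. -/
theorem LipschitzOnWith.indicator_closedBall {E : Type*} [NormedAddCommGroup E] [NormedSpace ℝ E]
    [Nontrivial E] {K : NNReal} {R : ℝ} (hR : 0 ≤ R) {p : E → E}
    (hp : LipschitzOnWith K p (Metric.closedBall 0 R)) (h0 : ∀ x, ‖x‖ = R → p x = 0) :
    LipschitzWith K ((Metric.closedBall (0 : E) R).indicator p) := by
  have hbound : ∀ x : E, ‖x‖ ≤ R → ‖p x‖ ≤ K * (R - ‖x‖) := by
    intro x hx
    obtain ⟨z, hz, hxz⟩ : ∃ z : E, ‖z‖ = R ∧ ‖x - z‖ = R - ‖x‖ := by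
      rcases eq_or_ne x 0 with rfl | hx0
      · obtain ⟨z, hz⟩ := exists_norm_eq E hR
        exact ⟨z, hz, by simp [hz]⟩
      · have hn : ‖x‖ ≠ 0 := norm_ne_zero_iff.2 hx0
        refine ⟨(R / ‖x‖) • x, ?_, ?_⟩
        · rw [norm_smul, Real.norm_of_nonneg (by positivity)]; field_simp
        · have : x - (R / ‖x‖) • x = -(((R - ‖x‖) / ‖x‖) • x) := by
            rw [sub_div, div_self hn, sub_smul, one_smul]; abel
          rw [this, norm_neg, norm_smul, Real.norm_of_nonneg
            (div_nonneg (sub_nonneg.2 hx) (norm_nonneg x))]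
          field_simp
    have := hp.norm_sub_le (x := x) (by simpa using hx) (y := z) (by simp [hz])
    rwa [h0 z hz, sub_zero, hxz] at this
  have hmixed : ∀ x y : E, ‖x‖ ≤ R → R < ‖y‖ → ‖p x‖ ≤ K * ‖x - y‖ := by
    intro x y hx hy
    refine (hbound x hx).trans (mul_le_mul_of_nonneg_left ?_ K.2)
    linarith [norm_sub_norm_le y x, norm_sub_rev x y]
  refine LipschitzWith.of_dist_le_mul fun x y => ?_
  rw [dist_eq_norm, dist_eq_norm]
  by_cases hx : ‖x‖ ≤ R <;> by_cases hy : ‖y‖ ≤ R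
  · rw [Set.indicator_of_mem (by simpa using hx), Set.indicator_of_mem (by simpa using hy)]
    exact hp.norm_sub_le (by simpa using hx) (by simpa using hy)
  · rw [Set.indicator_of_mem (by simpa using hx), Set.indicator_of_notMem (by simpa using hy),
      sub_zero]
    exact hmixed x y hx (not_le.1 hy)
  · rw [Set.indicator_of_notMem (by simpa using hx), Set.indicator_of_mem (by simpa using hy),
      zero_sub, norm_neg, norm_sub_rev]
    exact hmixed y x hy (not_le.1 hx)
  · rw [Set.indicator_of_notMem (by simpa using hx), Set.indicator_of_notMem (by simpa using hy),
      sub_zero, norm_zero]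
    positivity

/-- `det (1 + t • A)` is a polynomial in `t` of degree at most the dimension. -/
theorem LinearMap.exists_polynomial_eval_eq_det_one_add_smul {E : Type*} [AddCommGroup E]
    [Module ℝ E] [FiniteDimensional ℝ E] (A : E →ₗ[ℝ] E) :
    ∃ P : Polynomial ℝ, P.natDegree ≤ Module.finrank ℝ E ∧
      ∀ t : ℝ, P.eval t = LinearMap.det (1 + t • A) := by
  let b := Module.finBasis ℝ E
  let M := LinearMap.toMatrix b b A
  refine ⟨_, (Polynomial.natDegree_det_X_add_C_le M 1).trans (by simp), fun t => ?_⟩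
  rw [← LinearMap.det_toMatrix b, ← Polynomial.coe_evalRingHom, RingHom.map_det]
  congr 1
  ext i j
  simp only [M, RingHom.mapMatrix_apply, Matrix.map_apply, Matrix.add_apply, Matrix.smul_apply,
    map_add, map_smul, LinearMap.toMatrix_one, smul_eq_mul, Polynomial.coe_evalRingHom,
    Polynomial.eval_mul, Polynomial.eval_X, Polynomial.eval_C]
  exact add_comm _ _

/-- If `‖A‖ < 1`, then `det (1 + A)` is positive. -/
theorem ContinuousLinearMap.det_one_add_pos {E : Type*} [NormedAddCommGroup E] [NormedSpace ℝ E]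
    [FiniteDimensional ℝ E] (A : E →L[ℝ] E) (hA : ‖A‖ < 1) : 0 < (1 + A).det := by
  have : CompleteSpace E := FiniteDimensional.complete ℝ E
  by_contra! hneg
  have hcont : Continuous fun s : ℝ => (1 + s • A).det :=
    ContinuousLinearMap.continuous_det.comp (by fun_prop)
  obtain ⟨s, ⟨hs0, hs1⟩, hs⟩ := intermediate_value_Icc' (zero_le_one' ℝ) hcont.continuousOn
    (show (0 : ℝ) ∈ Set.Icc _ _ by
      refine ⟨by simpa using hneg, ?_⟩
      simp [ContinuousLinearMap.det])
  have hnorm : ‖-(s • A)‖ < 1 := by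
    rw [norm_neg, norm_smul, Real.norm_of_nonneg hs0]
    nlinarith [norm_nonneg A]
  have hu := isUnit_one_sub_of_norm_lt_one hnorm
  rw [sub_neg_eq_add] at hu
  have hu' : IsUnit ((1 + s • A : E →L[ℝ] E) : E →ₗ[ℝ] E) :=
    hu.map (ContinuousLinearMap.toLinearMapRingHom (R₁ := ℝ) (M₁ := E))
  exact (LinearMap.isUnit_det _ hu').ne_zero hs

open MeasureTheory in
/-- If a `C¹` vector field vanishes on a sphere and has derivative of norm less than one on the
ball, then the perturbation of the identity by it preserves the volume of the ball. -/
theorem integral_det_one_add_fderiv_of_lt_one {E : Type*} [NormedAddCommGroup E]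
    [InnerProductSpace ℝ E] [FiniteDimensional ℝ E] [MeasurableSpace E] [BorelSpace E]
    [Nontrivial E] {p : E → E} (hp : ContDiff ℝ 1 p) {R : ℝ} (hR : 0 ≤ R)
    (h0 : ∀ x, ‖x‖ = R → p x = 0) {K : NNReal} (hK : K < 1)
    (hpK : ∀ x ∈ Metric.closedBall (0 : E) R, ‖fderiv ℝ p x‖ ≤ K) :
    ∫ x in Metric.closedBall (0 : E) R, (1 + fderiv ℝ p x).det =
      volume.real (Metric.closedBall (0 : E) R) := by
  set B := Metric.closedBall (0 : E) R with hB
  have hdiff : Differentiable ℝ p := hp.differentiable one_ne_zero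
  have hLip : LipschitzOnWith K p B :=
    (convex_closedBall (0 : E) R).lipschitzOnWith_of_nnnorm_fderiv_le (𝕜 := ℝ)
      (fun x _ => hdiff x) hpK
  have hbij := LipschitzWith.bijective_id_add hK (hLip.indicator_closedBall hR h0)
  set F : E → E := fun x => x + B.indicator p x with hF
  have hFin : ∀ x ∈ B, F x = x + p x := fun x hx => by simp [hF, Set.indicator_of_mem hx]
  have hFout : ∀ x ∉ B, F x = x := fun x hx => by simp [hF, Set.indicator_of_notMem hx]
  have himage : (fun x => x + p x) '' B = B := by
    rw [← Set.image_congr hFin]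
    ext y
    constructor
    · rintro ⟨x, hx, rfl⟩
      by_contra hy
      exact hy (by rwa [hbij.1 (hFout _ hy)])
    · intro hy
      obtain ⟨x, rfl⟩ := hbij.2 y
      by_cases hx : x ∈ B
      · exact ⟨x, hx, rfl⟩
      · exact absurd (by rwa [← hFout x hx]) hx
  have hinj : Set.InjOn (fun x => x + p x) B := by
    intro x hx y hy hxy
    apply hbij.1
    rw [hFin x hx, hFin y hy]
    exact hxy
  have hcov := integral_image_eq_integral_abs_det_fderiv_smul volume
    (Metric.isClosed_closedBall (x := (0 : E)) (ε := R)).measurableSet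
    (f := fun x => x + p x) (f' := fun x => 1 + fderiv ℝ p x)
    (fun x _ => ((hasFDerivAt_id x).add (hdiff x).hasFDerivAt).hasFDerivWithinAt) hinj
    (fun _ => (1 : ℝ))
  rw [← hB, himage, setIntegral_const, smul_eq_mul, mul_one] at hcov
  rw [hcov]
  refine setIntegral_congr_fun Metric.isClosed_closedBall.measurableSet fun x hx => ?_
  have := ContinuousLinearMap.det_one_add_pos (fderiv ℝ p x) ((hpK x hx).trans_lt hK)
  simp [abs_of_pos this]

open MeasureTheory in
/-- If a `C¹` vector field vanishes on a sphere, then the integral over the ball of the Jacobian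
determinant of the corresponding perturbation of the identity is the volume of the ball. -/
theorem integral_det_one_add_fderiv {E : Type*} [NormedAddCommGroup E]
    [InnerProductSpace ℝ E] [FiniteDimensional ℝ E] [MeasurableSpace E] [BorelSpace E]
    [Nontrivial E] {p : E → E} (hp : ContDiff ℝ 1 p) {R : ℝ} (hR : 0 ≤ R)
    (h0 : ∀ x, ‖x‖ = R → p x = 0) :
    ∫ x in Metric.closedBall (0 : E) R, (1 + fderiv ℝ p x).det =
      volume.real (Metric.closedBall (0 : E) R) := by
  have hdiff : Differentiable ℝ p := hp.differentiable one_ne_zero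
  have hcont : Continuous (fderiv ℝ p) := hp.continuous_fderiv one_ne_zero
  obtain ⟨C, hC⟩ := (isCompact_closedBall (0 : E) R).exists_bound_of_continuousOn
    hcont.continuousOn
  have hC0 : 0 ≤ C := (norm_nonneg _).trans (hC 0 (by simpa using hR))
  have hsmall : ∀ t ∈ Set.Ioo (0 : ℝ) (1 / (C + 1)),
      ∫ x in Metric.closedBall (0 : E) R, (1 + t • fderiv ℝ p x).det =
        volume.real (Metric.closedBall (0 : E) R) := by
    intro t ht
    have hfd : ∀ x, fderiv ℝ (t • p) x = t • fderiv ℝ p x := fun x =>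
      fderiv_const_smul (hdiff x) t
    have htC : t * C < 1 := by
      have := (lt_div_iff₀ (by positivity)).1 ht.2
      nlinarith [ht.1]
    have := integral_det_one_add_fderiv_of_lt_one (p := t • p) (hp.const_smul t) hR
      (fun x hx => by simp [h0 x hx]) (K := ⟨t * C, mul_nonneg ht.1.le hC0⟩)
      (by exact_mod_cast htC) (fun x hx => by
        rw [hfd, norm_smul, Real.norm_of_nonneg ht.1.le]
        exact mul_le_mul_of_nonneg_left (hC x hx) ht.1.le)
    simpa only [hfd] using this
  obtain ⟨s, hs, hcard⟩ := (Set.Ioo_infinite (show (0 : ℝ) < 1 / (C + 1) by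
    positivity)).exists_subset_card_eq (Module.finrank ℝ E + 1)
  let w : ℝ → ℝ := fun t => (Lagrange.basis s id t).eval 1
  have hpoly : ∀ P : Polynomial ℝ, P.natDegree ≤ Module.finrank ℝ E →
      P.eval 1 = ∑ t ∈ s, P.eval t * w t := by
    intro P hP
    conv_lhs => rw [Lagrange.eq_interpolate (s := s) (v := id) (f := P) Function.injective_id.injOn
      (Polynomial.degree_le_natDegree.trans_lt (by rw [hcard]; exact_mod_cast Nat.lt_succ_of_le hP))]
    simp [Lagrange.interpolate_apply, Polynomial.eval_finsetSum, w]
  have hw : ∑ t ∈ s, w t = 1 := by simpa using (hpoly 1 (by simp)).symm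
  have hdet : ∀ x, (1 + fderiv ℝ p x).det = ∑ t ∈ s, (1 + t • fderiv ℝ p x).det * w t := by
    intro x
    obtain ⟨P, hP, hPe⟩ :=
      LinearMap.exists_polynomial_eval_eq_det_one_add_smul (fderiv ℝ p x : E →ₗ[ℝ] E)
    have h := hpoly P hP
    simp only [hPe, one_smul] at h
    exact h
  simp only [hdet]
  rw [integral_finsetSum]
  · simp only [integral_mul_const]
    rw [Finset.sum_congr rfl fun t ht => by rw [hsmall t (hs ht)], ← Finset.mul_sum, hw, mul_one]
  · intro t _
    refine ContinuousOn.integrableOn_compact (isCompact_closedBall 0 R)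
      (Continuous.continuousOn ?_)
    exact (ContinuousLinearMap.continuous_det.comp (by fun_prop)).mul continuous_const

/-- There is no `C¹` retraction onto a sphere. -/
theorem not_contDiff_retraction_sphere {E : Type*} [NormedAddCommGroup E]
    [InnerProductSpace ℝ E] [FiniteDimensional ℝ E] {h : E → E} (hh : ContDiff ℝ 1 h) {R : ℝ}
    (hR : 0 < R) (hnorm : ∀ x, ‖h x‖ = R) : ¬ ∀ x, ‖x‖ = R → h x = x := by
  intro hfix
  borelize E
  have : Nontrivial E := ⟨h 0, 0, fun h0 => by simpa [h0, hR.ne] using hnorm 0⟩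
  have hdiff : Differentiable ℝ h := hh.differentiable one_ne_zero
  have hint := integral_det_one_add_fderiv (p := fun x => h x - x) (hh.sub contDiff_id) hR.le
    (fun x hx => by simp [hfix x hx])
  have hfd : ∀ x, 1 + fderiv ℝ (fun x => h x - x) x = fderiv ℝ h x := by
    intro x
    rw [fderiv_fun_sub (hdiff x) differentiableAt_fun_id, fderiv_fun_id]
    exact add_sub_cancel _ _
  have hdet : ∀ x, (fderiv ℝ h x).det = 0 := by
    intro x
    by_contra hne
    have h1 : HasFDerivAt (fun y => ‖h y‖ ^ 2) _ x := (hdiff x).hasFDerivAt.norm_sq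
    simp only [hnorm] at h1
    have h2 := h1.unique (hasFDerivAt_const (R ^ 2) x)
    obtain ⟨v, hv⟩ := (LinearMap.equivOfDetNeZero (fderiv ℝ h x : E →ₗ[ℝ] E) hne).surjective (h x)
    have hv' : fderiv ℝ h x v = h x := hv
    have h3 := congrArg (fun L : E →L[ℝ] ℝ => L v) h2
    simp [hv', hnorm, hR.ne'] at h3
  simp only [hfd, hdet, MeasureTheory.integral_zero] at hint
  have hpos := Metric.measure_closedBall_pos MeasureTheory.volume (0 : E) hR
  exact hpos.ne' ((MeasureTheory.measureReal_eq_zero_iff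
    Metric.isBounded_closedBall.measure_lt_top.ne).1 hint.symm)

/-- A bounded `C¹` self-map of a Euclidean space has a fixed point. -/
theorem ContDiff.exists_fixedPoint_of_bounded {E : Type*} [NormedAddCommGroup E]
    [InnerProductSpace ℝ E] [FiniteDimensional ℝ E] {G : E → E} (hG : ContDiff ℝ 1 G) {M : ℝ}
    (hM : ∀ x, ‖G x‖ ≤ M) : ∃ x, G x = x := by
  by_contra! hne
  have hM0 : 0 ≤ M := (norm_nonneg _).trans (hM 0)
  let χ : ContDiffBump (0 : E) := ⟨M + 1, M + 2, by linarith, by linarith⟩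
  let f : E → E := fun x => x - χ x • G x
  have hf : ContDiff ℝ 1 f := contDiff_id.sub ((χ.contDiff (n := 1)).smul hG)
  have hf0 : ∀ x, f x ≠ 0 := by
    intro x hx
    have hx' : x = χ x • G x := sub_eq_zero.1 hx
    have hxM : ‖x‖ ≤ M := by
      rw [hx', norm_smul, Real.norm_of_nonneg χ.nonneg]
      nlinarith [χ.le_one (x := x), hM x, norm_nonneg (G x), χ.nonneg (x := x)]
    have h1 : χ x = 1 := χ.one_of_mem_closedBall (by
      rw [mem_closedBall_zero_iff]; exact hxM.trans (by simp [χ]))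
    rw [h1, one_smul] at hx'
    exact hne x hx'.symm
  have hn : ∀ x, ‖f x‖ ≠ 0 := fun x => norm_ne_zero_iff.2 (hf0 x)
  refine not_contDiff_retraction_sphere (h := fun x => ((M + 2) / ‖f x‖) • f x) (R := M + 2)
    ((contDiff_const.div (hf.norm ℝ hf0) hn).smul hf) (by linarith) (fun x => ?_) (fun x hx => ?_)
  · rw [norm_smul, Real.norm_of_nonneg (by positivity)]
    field_simp [hn x]
  · have hfx : f x = x := by
      simp [f, χ.zero_of_le_dist (x := x) (by simp [χ, hx])]
    rw [hfx, hx, div_self (by linarith), one_smul]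

/-- A real quadratic form is bounded by a multiple of the squared Euclidean norm. -/
theorem Matrix.abs_dotProduct_mulVec_self_le {ι : Type*} [Fintype ι] (B : Matrix ι ι ℝ)
    (v : ι → ℝ) : |v ⬝ᵥ B *ᵥ v| ≤ (∑ j, ∑ l, |B j l|) * (v ⬝ᵥ v) := by
  have hv : ∀ j, v j ^ 2 ≤ v ⬝ᵥ v := fun j => by
    simp only [dotProduct, ← sq]
    exact Finset.single_le_sum (f := fun j => v j ^ 2) (fun _ _ => sq_nonneg _) (Finset.mem_univ j)
  have hjl : ∀ j l, |v j * (B j l * v l)| ≤ |B j l| * (v ⬝ᵥ v) := fun j l => by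
    have h1 : |v j| * |v l| ≤ v ⬝ᵥ v := by
      nlinarith [hv j, hv l, sq_abs (v j), sq_abs (v l), sq_nonneg (|v j| - |v l|)]
    calc |v j * (B j l * v l)| = |B j l| * (|v j| * |v l|) := by rw [abs_mul, abs_mul]; ring
      _ ≤ _ := mul_le_mul_of_nonneg_left h1 (abs_nonneg _)
  simp only [Finset.sum_mul]
  calc |v ⬝ᵥ B *ᵥ v| = |∑ j, ∑ l, v j * (B j l * v l)| := by
        simp only [dotProduct, mulVec, Finset.mul_sum]
    _ ≤ ∑ j, ∑ l, |v j * (B j l * v l)| :=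
        (Finset.abs_sum_le_sum_abs _ _).trans
          (Finset.sum_le_sum fun _ _ => Finset.abs_sum_le_sum_abs _ _)
    _ ≤ _ := Finset.sum_le_sum fun j _ => Finset.sum_le_sum fun l _ => hjl j l

/-- The point `(u, 0, -1)` of the affine chart of the lower open hemisphere. -/
noncomputable def hemisphereChart {m : ℕ} (k : ℕ) (u : EuclideanSpace ℝ (Fin m)) :
    Fin (m + k + 1) → ℝ :=
  Fin.snoc (α := fun _ => ℝ) (Fin.append (fun i => u i) (0 : Fin k → ℝ)) (-1)

theorem hemisphereChart_dotProduct_self {m : ℕ} (k : ℕ) (u : EuclideanSpace ℝ (Fin m)) :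
    hemisphereChart k u ⬝ᵥ hemisphereChart k u = 1 + ‖u‖ ^ 2 := by
  simp [hemisphereChart, dotProduct, Fin.sum_univ_castSucc, Fin.sum_univ_add,
    EuclideanSpace.norm_sq_eq, ← sq, add_comm]

theorem contDiff_hemisphereChart_apply {m : ℕ} (k : ℕ) (j : Fin (m + k + 1)) :
    ContDiff ℝ 1 fun u : EuclideanSpace ℝ (Fin m) => hemisphereChart k u j := by
  refine Fin.lastCases ?_ (fun j => Fin.addCases (fun i => ?_) (fun i => ?_) j) j
  · simp only [hemisphereChart, Fin.snoc_last]
    exact contDiff_const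
  · simp only [hemisphereChart, Fin.snoc_castSucc, Fin.append_left]
    fun_prop
  · simp only [hemisphereChart, Fin.snoc_castSucc, Fin.append_right]
    exact contDiff_const

/-- For any `m` quadratic forms `A i` in at least `m + 1` variables there is a vector `(u, 0, -1)` on which
`A i` takes the value `-u i * ‖(u, 0, -1)‖ ^ 2`. -/
theorem exists_hemisphereChart_dotProduct_mulVec_eq {m k : ℕ}
    (A : Fin m → Matrix (Fin (m + k + 1)) (Fin (m + k + 1)) ℝ) :
    ∃ u : EuclideanSpace ℝ (Fin m), ∀ i,
      hemisphereChart k u ⬝ᵥ A i *ᵥ hemisphereChart k u = -u i * (1 + ‖u‖ ^ 2) := by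
  let G : EuclideanSpace ℝ (Fin m) → EuclideanSpace ℝ (Fin m) := fun u => WithLp.toLp 2 fun i =>
    -(hemisphereChart k u ⬝ᵥ A i *ᵥ hemisphereChart k u) / (1 + ‖u‖ ^ 2)
  have hpos : ∀ u : EuclideanSpace ℝ (Fin m), 0 < 1 + ‖u‖ ^ 2 := fun u => by positivity
  have hG : ContDiff ℝ 1 G := by
    rw [contDiff_euclidean]
    intro i
    refine ContDiff.div (ContDiff.neg ?_) (contDiff_const.add (ContDiff.norm_sq ℝ contDiff_id))
      fun u => (hpos u).ne'
    simp only [dotProduct, mulVec]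
    exact ContDiff.sum fun j _ => (contDiff_hemisphereChart_apply k j).mul
      (ContDiff.sum fun l _ => contDiff_const.mul (contDiff_hemisphereChart_apply k l))
  have hM : ∀ u, ‖G u‖ ≤ √(∑ i, (∑ j, ∑ l, |A i j l|) ^ 2) := by
    intro u
    rw [EuclideanSpace.norm_eq]
    refine Real.sqrt_le_sqrt (Finset.sum_le_sum fun i _ => pow_le_pow_left₀ (norm_nonneg _) ?_ 2)
    simp only [G, Real.norm_eq_abs, abs_div, abs_neg, abs_of_pos (hpos u)]
    rw [div_le_iff₀ (hpos u), ← hemisphereChart_dotProduct_self k u]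
    exact (A i).abs_dotProduct_mulVec_self_le _
  obtain ⟨u, hu⟩ := hG.exists_fixedPoint_of_bounded hM
  refine ⟨u, fun i => ?_⟩
  have hi : -(hemisphereChart k u ⬝ᵥ A i *ᵥ hemisphereChart k u) / (1 + ‖u‖ ^ 2) = u i :=
    congrArg (fun v : EuclideanSpace ℝ (Fin m) => v i) hu
  rw [div_eq_iff (hpos u).ne'] at hi
  linarith

theorem stmt_3 {n m : ℕ} (hmn : m + 1 ≤ n)
    (A : Fin m → Matrix (Fin n) (Fin n) ℝ) (hA : ∀ i, (A i).IsSymm)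
    (h : ¬ ∃ x : Fin n → ℝ, x ⬝ᵥ x = 1 ∧ ∀ i, x ⬝ᵥ (A i) *ᵥ x = 0) :
    ∃ (xh : Fin n → ℝ) (δ : ℝ), xh ⬝ᵥ xh = 1 ∧ δ = -(xh ⟨n - 1, by omega⟩) ∧
      δ ∈ Set.Ioo (0 : ℝ) 1 ∧
      (∀ i : Fin m, xh ⬝ᵥ (A i) *ᵥ xh = -(xh (Fin.castLE (by omega) i)) / δ) ∧
      xh ⬝ᵥ (∑ i, (-(xh (Fin.castLE (by omega) i))) • A i) *ᵥ xh = (1 - δ ^ 2) / δ ∧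
      0 < (1 - δ ^ 2) / δ := by
  obtain ⟨k, rfl⟩ : ∃ k, n = m + k + 1 := ⟨n - (m + 1), by omega⟩
  obtain ⟨u, hu⟩ := exists_hemisphereChart_dotProduct_mulVec_eq A
  set r : ℝ := √(1 + ‖u‖ ^ 2)
  have hr2 : r ^ 2 = 1 + ‖u‖ ^ 2 := Real.sq_sqrt (by positivity)
  have hr0 : 0 < r := Real.sqrt_pos.2 (by positivity)
  set y := hemisphereChart k u
  have hyy : y ⬝ᵥ y = r ^ 2 := by rw [hr2]; exact hemisphereChart_dotProduct_self k u
  have hlast : y ⟨m + k + 1 - 1, by omega⟩ = -1 :=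
    Fin.snoc_last (α := fun _ => ℝ) _ _
  have hcoord : ∀ i : Fin m, y (Fin.castLE (by omega) i) = u i := fun i =>
    (Fin.snoc_castSucc (α := fun _ => ℝ) _ _ (Fin.castAdd k i)).trans (Fin.append_left _ _ i)
  have hquad : ∀ B : Matrix (Fin (m + k + 1)) (Fin (m + k + 1)) ℝ,
      (r⁻¹ • y) ⬝ᵥ B *ᵥ (r⁻¹ • y) = (y ⬝ᵥ B *ᵥ y) / r ^ 2 := fun B => by
    rw [mulVec_smul, smul_dotProduct, dotProduct_smul, smul_eq_mul, smul_eq_mul]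
    field_simp
  have hunit : (r⁻¹ • y) ⬝ᵥ (r⁻¹ • y) = 1 := by
    rw [smul_dotProduct, dotProduct_smul, hyy, smul_eq_mul, smul_eq_mul]
    field_simp
  have hvalue : ∀ i, (r⁻¹ • y) ⬝ᵥ A i *ᵥ (r⁻¹ • y) = -u i := fun i => by
    rw [hquad, hu, ← hr2]
    field_simp
  have hu0 : u ≠ 0 := by
    rintro rfl
    exact h ⟨r⁻¹ • y, hunit, fun i => by simp [hvalue]⟩
  have hr1 : 1 < r := by
    have := norm_pos_iff.2 hu0
    nlinarith
  have hfinal : (1 - r⁻¹ ^ 2) / r⁻¹ = r⁻¹ * ‖u‖ ^ 2 := by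
    rw [show ‖u‖ ^ 2 = r ^ 2 - 1 by linarith]
    field_simp
  refine ⟨r⁻¹ • y, r⁻¹, hunit, ?_, ⟨inv_pos.2 hr0, inv_lt_one_of_one_lt₀ hr1⟩, fun i => ?_, ?_, ?_⟩
  · rw [Pi.smul_apply, hlast, smul_eq_mul, mul_neg, mul_one, neg_neg]
  · rw [hvalue, Pi.smul_apply, hcoord, smul_eq_mul]
    field_simp
  · rw [hfinal, sum_mulVec, dotProduct_sum, EuclideanSpace.norm_sq_eq, Finset.mul_sum]
    refine Finset.sum_congr rfl fun i _ => ?_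
    rw [smul_mulVec, dotProduct_smul, hvalue, Pi.smul_apply, hcoord, smul_eq_mul, smul_eq_mul,
      Real.norm_eq_abs, sq_abs]
    ring
  · rw [hfinal]
    have := norm_pos_iff.2 hu0
    positivity
end

section
/- Let A_1,…,A_m be real symmetric n×n matrices and let t_1,…,t_m ∈ ℝ be such that ∑_{i=1}^m t_i A_i is positive semidefinite and I − ∑_{i=1}^m t_i A_i is positive semidefinite (I the n×n identity). Then every nonzero positive semidefinite matrix X satisfying ⟨A_i, X⟩ = 0 for all i = 1,…,m satisfies rank(X) ≤ n − ⌈∑_{i=1}^m t_i tr(A_i)⌉. -/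
open Matrix

open scoped MatrixOrder in
/-- Two positive semidefinite matrices whose product has trace zero have product zero. -/
theorem Matrix.PosSemidef.mul_eq_zero_of_trace_mul_eq_zero {ι : Type*} [Fintype ι]
    {S X : Matrix ι ι ℝ} (hS : S.PosSemidef) (hX : X.PosSemidef)
    (h : (S * X).trace = 0) : S * X = 0 := by
  classical
  obtain ⟨B, rfl⟩ := CStarAlgebra.nonneg_iff_eq_star_mul_self.mp hS.nonneg
  obtain ⟨C, rfl⟩ := CStarAlgebra.nonneg_iff_eq_star_mul_self.mp hX.nonneg
  simp only [star_eq_conjTranspose] at h ⊢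
  have hCB : C * Bᴴ = 0 := by
    rw [← trace_conjTranspose_mul_self_eq_zero_iff, conjTranspose_mul,
      conjTranspose_conjTranspose, ← h, Matrix.mul_assoc Bᴴ, trace_mul_comm Bᴴ]
    simp only [Matrix.mul_assoc]
  have hBC : B * Cᴴ = 0 := by
    rw [← conjTranspose_eq_zero, conjTranspose_mul, conjTranspose_conjTranspose, hCB]
  rw [Matrix.mul_assoc, ← Matrix.mul_assoc B, hBC, Matrix.zero_mul, Matrix.mul_zero]

/-- A Hermitian real matrix bounded above by the identity has all eigenvalues at most one. -/
theorem Matrix.IsHermitian.eigenvalues_le_one {ι : Type*} [Fintype ι] [DecidableEq ι]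
    {S : Matrix ι ι ℝ} (hS : S.IsHermitian) (h : (1 - S).PosSemidef) (i : ι) :
    hS.eigenvalues i ≤ 1 := by
  set v : ι → ℝ := ⇑(hS.eigenvectorBasis i) with hv
  have hvv : star v ⬝ᵥ v = 1 := by
    have h1 : inner ℝ (hS.eigenvectorBasis i) (hS.eigenvectorBasis i) = 1 := by
      simp
    rw [EuclideanSpace.inner_eq_star_dotProduct, dotProduct_comm] at h1
    exact h1
  have h2 := h.dotProduct_mulVec_nonneg v
  rw [sub_mulVec, one_mulVec, hv, hS.mulVec_eigenvectorBasis, ← hv, dotProduct_sub,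
    dotProduct_smul, hvv, smul_eq_mul, mul_one] at h2
  linarith

/-- A Hermitian real matrix bounded above by the identity has trace at most its rank. -/
theorem Matrix.IsHermitian.trace_le_rank {ι : Type*} [Fintype ι] [DecidableEq ι]
    {S : Matrix ι ι ℝ} (hS : S.IsHermitian) (h : (1 - S).PosSemidef) :
    S.trace ≤ S.rank := by
  rw [hS.trace_eq_sum_eigenvalues, hS.rank_eq_card_non_zero_eigs, Fintype.card_subtype,
    Finset.card_filter, Nat.cast_sum]
  refine Finset.sum_le_sum fun i _ => ?_
  have := hS.eigenvalues_le_one h i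
  by_cases h0 : hS.eigenvalues i = 0 <;> simp [h0, this]

theorem stmt_14 {n m : ℕ}
    (A : Fin m → Matrix (Fin n) (Fin n) ℝ) (hA : ∀ i, (A i).IsSymm)
    (t : Fin m → ℝ)
    (ht1 : (∑ i, t i • A i).PosSemidef)
    (ht2 : ((1 : Matrix (Fin n) (Fin n) ℝ) - ∑ i, t i • A i).PosSemidef)
    (X : Matrix (Fin n) (Fin n) ℝ) (hX : X.PosSemidef) (hX0 : X ≠ 0)
    (hXA : ∀ i, (A i * X).trace = 0) :
    (X.rank : ℤ) ≤ (n : ℤ) - ⌈∑ i, t i * (A i).trace⌉ := by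
  have htr : ((∑ i, t i • A i) * X).trace = 0 := by
    simp [Finset.sum_mul, trace_sum, hXA]
  have hrank := rank_add_rank_le_card_of_mul_eq_zero
    (ht1.mul_eq_zero_of_trace_mul_eq_zero hX htr)
  rw [Fintype.card_fin] at hrank
  have hle := ht1.isHermitian.trace_le_rank ht2
  have hceil : ⌈∑ i, t i * (A i).trace⌉ ≤ ((∑ i, t i • A i).rank : ℤ) := by
    rw [Int.ceil_le]
    simpa [trace_sum] using hle
  lia
end
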